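/- arXiv:2204.00073 — 12 statements merged into one kernel-verified Lean document; each statement's English description precedes it below -/
import Mathlib

section
/- Let a < b be real numbers, let f, g : ℝ → ℝ be continuous on [a,b] with g(t) > 0 for all t ∈ [a,b], let r₀ ∈ ℝ and s₀ ≥ 0, and for a ≤ t₀ < t₁ ≤ b define ψ(t₀,t₁) = (∫_{t₀}^{t₁} f(t) dt + r₀·(t₁ − t₀)) / (∫_{t₀}^{t₁} g(t) dt + s₀·(t₁ − t₀)). Then the supremum of ψ(t₀,t₁) over all pairs (t₀,t₁) with a ≤ t₀ < t₁ ≤ b equals the supremum over t ∈ [a,b] of (f(t) + r₀)/(g(t) + s₀). -/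
/-- A continuous function on `[a, b]` with nonpositive integral over every nondegenerate
subinterval is nonpositive, and conversely. -/
theorem ContinuousOn.forall_integral_nonpos_iff {a b : ℝ} (hab : a < b) {h : ℝ → ℝ}
    (hh : ContinuousOn h (Set.Icc a b)) :
    (∀ t₀ t₁, a ≤ t₀ → t₀ < t₁ → t₁ ≤ b → ∫ t in t₀..t₁, h t ≤ 0) ↔
      ∀ t ∈ Set.Icc a b, h t ≤ 0 := by
  constructor
  · intro H t ht
    by_contra! hpos
    obtain ⟨δ, hδ, hball⟩ := Metric.mem_nhdsWithin_iff.1 (hh t ht (Ioi_mem_nhds hpos))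
    have hlt : max a (t - δ / 2) < min b (t + δ / 2) := by
      rw [max_lt_iff, lt_min_iff, lt_min_iff]
      exact ⟨⟨hab, by linarith [ht.1]⟩, by linarith [ht.2], by linarith⟩
    have hsub : Set.Icc (max a (t - δ / 2)) (min b (t + δ / 2)) ⊆ Set.Icc a b :=
      Set.Icc_subset_Icc (le_max_left _ _) (min_le_left _ _)
    refine (H _ _ (le_max_left _ _) hlt (min_le_left _ _)).not_gt ?_
    refine intervalIntegral.intervalIntegral_pos_of_pos_on
      ((hh.mono hsub).intervalIntegrable_of_Icc hlt.le) (fun x hx => ?_) hlt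
    refine hball ⟨?_, hsub (Set.Ioo_subset_Icc_self hx)⟩
    rw [Metric.mem_ball, Real.dist_eq, abs_lt]
    constructor
    · linarith [(max_lt_iff.1 hx.1).2]
    · linarith [(lt_min_iff.1 hx.2).2]
  · intro H t₀ t₁ h₀ hlt h₁
    have := intervalIntegral.integral_nonneg (f := fun t => -h t) (μ := MeasureTheory.volume) hlt.le
      fun t ht => neg_nonneg.2 (H t ⟨h₀.trans ht.1, ht.2.trans h₁⟩)
    rw [intervalIntegral.integral_neg] at this
    linarith

theorem fractionalFunction_sSup_eq (a b : ℝ) (hab : a < b) (f g : ℝ → ℝ)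
    (hf : ContinuousOn f (Set.Icc a b)) (hg : ContinuousOn g (Set.Icc a b))
    (hgpos : ∀ t ∈ Set.Icc a b, 0 < g t)
    (r₀ s₀ : ℝ) (hs₀ : 0 ≤ s₀)
    (ψ : ℝ → ℝ → ℝ)
    (hψ : ∀ t₀ t₁, a ≤ t₀ → t₀ < t₁ → t₁ ≤ b → ψ t₀ t₁ =
      ((∫ t in t₀..t₁, f t) + r₀ * (t₁ - t₀)) /
      ((∫ t in t₀..t₁, g t) + s₀ * (t₁ - t₀))) :
    sSup {x : ℝ | ∃ t₀ t₁, a ≤ t₀ ∧ t₀ < t₁ ∧ t₁ ≤ b ∧ x = ψ t₀ t₁} =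
    sSup {x : ℝ | ∃ t ∈ Set.Icc a b, x = (f t + r₀) / (g t + s₀)} := by
  have hG : ∀ t ∈ Set.Icc a b, 0 < g t + s₀ := fun t ht => add_pos_of_pos_of_nonneg (hgpos t ht) hs₀
  have hub : ∀ c, (∀ t₀ t₁, a ≤ t₀ → t₀ < t₁ → t₁ ≤ b → ψ t₀ t₁ ≤ c) ↔
      ∀ t ∈ Set.Icc a b, (f t + r₀) / (g t + s₀) ≤ c := by
    intro c
    have hcont : ContinuousOn (fun t => f t + r₀ - c * (g t + s₀)) (Set.Icc a b) := by fun_prop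
    have hpointwise : (∀ t ∈ Set.Icc a b, (f t + r₀) / (g t + s₀) ≤ c) ↔
        ∀ t ∈ Set.Icc a b, f t + r₀ - c * (g t + s₀) ≤ 0 :=
      forall₂_congr fun t ht => by rw [div_le_iff₀ (hG t ht), sub_nonpos]
    rw [hpointwise, ← hcont.forall_integral_nonpos_iff hab]
    refine forall₅_congr fun t₀ t₁ h₀ hlt h₁ => ?_
    have hsub : Set.Icc t₀ t₁ ⊆ Set.Icc a b := Set.Icc_subset_Icc h₀ h₁
    have hfi : IntervalIntegrable f MeasureTheory.volume t₀ t₁ :=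
      (hf.mono hsub).intervalIntegrable_of_Icc hlt.le
    have hgi : IntervalIntegrable g MeasureTheory.volume t₀ t₁ :=
      (hg.mono hsub).intervalIntegrable_of_Icc hlt.le
    have hden : 0 < (∫ t in t₀..t₁, g t) + s₀ * (t₁ - t₀) :=
      add_pos_of_pos_of_nonneg
        (intervalIntegral.intervalIntegral_pos_of_pos_on hgi
          (fun x hx => hgpos x (hsub (Set.Ioo_subset_Icc_self hx))) hlt)
        (mul_nonneg hs₀ (sub_nonneg.2 hlt.le))
    rw [hψ t₀ t₁ h₀ hlt h₁, div_le_iff₀ hden,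
      intervalIntegral.integral_sub (hfi.add intervalIntegrable_const)
        ((hgi.add intervalIntegrable_const).const_mul c),
      intervalIntegral.integral_const_mul,
      intervalIntegral.integral_add hfi intervalIntegrable_const,
      intervalIntegral.integral_add hgi intervalIntegrable_const,
      intervalIntegral.integral_const, intervalIntegral.integral_const, smul_eq_mul, smul_eq_mul,
      sub_nonpos, mul_comm r₀, mul_comm s₀]
  have hratio : ContinuousOn (fun t => (f t + r₀) / (g t + s₀)) (Set.Icc a b) :=
    (hf.add continuousOn_const).div (hg.add continuousOn_const) fun t ht => (hG t ht).ne'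
  obtain ⟨m, hm, hmax⟩ := isCompact_Icc.exists_isMaxOn (Set.nonempty_Icc.2 hab.le) hratio
  have hlub : IsLUB {x : ℝ | ∃ t ∈ Set.Icc a b, x = (f t + r₀) / (g t + s₀)}
      ((f m + r₀) / (g m + s₀)) := by
    refine IsGreatest.isLUB ⟨⟨m, hm, rfl⟩, ?_⟩
    rintro _ ⟨t, ht, rfl⟩
    exact hmax ht
  have hbounds : upperBounds {x : ℝ | ∃ t₀ t₁, a ≤ t₀ ∧ t₀ < t₁ ∧ t₁ ≤ b ∧ x = ψ t₀ t₁} =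
      upperBounds {x : ℝ | ∃ t ∈ Set.Icc a b, x = (f t + r₀) / (g t + s₀)} := by
    ext c
    have := hub c
    constructor
    · rintro hc _ ⟨t, ht, rfl⟩
      exact this.1 (fun t₀ t₁ h₀ hlt h₁ => hc ⟨t₀, t₁, h₀, hlt, h₁, rfl⟩) t ht
    · rintro hc _ ⟨t₀, t₁, h₀, hlt, h₁, rfl⟩
      exact this.2 (fun t ht => hc ⟨t, ht, rfl⟩) t₀ t₁ h₀ hlt h₁
  rw [hlub.csSup_eq ⟨_, m, hm, rfl⟩,
    ((isLUB_congr hbounds).2 hlub).csSup_eq ⟨_, a, b, le_rfl, hab, le_rfl, rfl⟩]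
end

section
/- Let a < b be real numbers, let f, g : ℝ → ℝ be continuous on [a,b] with g(t) > 0 for all t ∈ [a,b], let r₀ ∈ ℝ and s₀ ≥ 0, and for a ≤ t₀ < t₁ ≤ b define ψ(t₀,t₁) = (∫_{t₀}^{t₁} f(t) dt + r₀·(t₁ − t₀)) / (∫_{t₀}^{t₁} g(t) dt + s₀·(t₁ − t₀)). Then the infimum of ψ(t₀,t₁) over all pairs (t₀,t₁) with a ≤ t₀ < t₁ ≤ b equals the infimum over t ∈ [a,b] of (f(t) + r₀)/(g(t) + s₀). -/
theorem intervalIntegral_add_const_mul {f : ℝ → ℝ} {u v : ℝ} (r : ℝ)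
    (huv : u ≤ v) (hf : ContinuousOn f (Set.Icc u v)) :
    (∫ t in u..v, f t) + r * (v - u) = ∫ t in u..v, (f t + r) := by
  rw [intervalIntegral.integral_add (hf.intervalIntegrable_of_Icc huv) intervalIntegrable_const,
    intervalIntegral.integral_const, smul_eq_mul, mul_comm r]

theorem exists_Icc_subset_of_mem_nhdsWithin_Icc {a b t : ℝ} (hab : a < b)
    (ht : t ∈ Set.Icc a b) {s : Set ℝ} (hs : s ∈ nhdsWithin t (Set.Icc a b)) :
    ∃ u v, a ≤ u ∧ u < v ∧ v ≤ b ∧ Set.Icc u v ⊆ s := by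
  obtain ⟨ε, hε, hsub⟩ := Metric.mem_nhdsWithin_iff.1 hs
  obtain ⟨hta, htb⟩ := ht
  refine ⟨max a (t - ε / 2), min b (t + ε / 2), le_max_left _ _, ?_, min_le_left _ _, ?_⟩
  · rw [max_lt_iff, lt_min_iff, lt_min_iff]
    refine ⟨⟨hab, ?_⟩, ?_, ?_⟩ <;> linarith
  · rintro x ⟨hx₁, hx₂⟩
    rw [max_le_iff] at hx₁
    rw [le_min_iff] at hx₂
    refine hsub ⟨?_, hx₁.1, hx₂.1⟩
    rw [Metric.mem_ball, Real.dist_eq, abs_lt]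
    constructor <;> linarith

theorem fractionalFunction_sInf_eq (a b : ℝ) (hab : a < b) (f g : ℝ → ℝ)
    (hf : ContinuousOn f (Set.Icc a b)) (hg : ContinuousOn g (Set.Icc a b))
    (hgpos : ∀ t ∈ Set.Icc a b, 0 < g t)
    (r₀ s₀ : ℝ) (hs₀ : 0 ≤ s₀)
    (ψ : ℝ → ℝ → ℝ)
    (hψ : ∀ t₀ t₁, a ≤ t₀ → t₀ < t₁ → t₁ ≤ b → ψ t₀ t₁ =
      ((∫ t in t₀..t₁, f t) + r₀ * (t₁ - t₀)) /
      ((∫ t in t₀..t₁, g t) + s₀ * (t₁ - t₀))) :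
    sInf {x : ℝ | ∃ t₀ t₁, a ≤ t₀ ∧ t₀ < t₁ ∧ t₁ ≤ b ∧ x = ψ t₀ t₁} =
    sInf {x : ℝ | ∃ t ∈ Set.Icc a b, x = (f t + r₀) / (g t + s₀)} := by
  have hF : ContinuousOn (fun t => f t + r₀) (Set.Icc a b) := hf.add continuousOn_const
  have hG : ContinuousOn (fun t => g t + s₀) (Set.Icc a b) := hg.add continuousOn_const
  have hGpos : ∀ t ∈ Set.Icc a b, 0 < g t + s₀ := fun t ht =>
    add_pos_of_pos_of_nonneg (hgpos t ht) hs₀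
  have hquot : ContinuousOn (fun t => (f t + r₀) / (g t + s₀)) (Set.Icc a b) :=
    hF.div hG fun t ht => (hGpos t ht).ne'
  have hψ_eq : ∀ u v, a ≤ u → u < v → v ≤ b →
      ψ u v = (∫ t in u..v, (f t + r₀)) / ∫ t in u..v, (g t + s₀) := by
    intro u v hu huv hv
    have hsub := Set.Icc_subset_Icc hu hv
    rw [hψ u v hu huv hv, intervalIntegral_add_const_mul r₀ huv.le (hf.mono hsub),
      intervalIntegral_add_const_mul s₀ huv.le (hg.mono hsub)]
  have hint_pos : ∀ u v, a ≤ u → u < v → v ≤ b → 0 < ∫ t in u..v, (g t + s₀) := by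
    intro u v hu huv hv
    have hsub := Set.Icc_subset_Icc hu hv
    exact intervalIntegral.intervalIntegral_pos_of_pos_on
      ((hG.mono hsub).intervalIntegrable_of_Icc huv.le)
      (fun t ht => hGpos t (hsub (Set.Ioo_subset_Icc_self ht))) huv
  obtain ⟨m, hm, hmin⟩ := isCompact_Icc.exists_isMinOn (Set.nonempty_Icc.2 hab.le) hquot
  have hleast : IsLeast {x : ℝ | ∃ t ∈ Set.Icc a b, x = (f t + r₀) / (g t + s₀)}
      ((f m + r₀) / (g m + s₀)) := by
    refine ⟨⟨m, hm, rfl⟩, ?_⟩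
    rintro _ ⟨t, ht, rfl⟩
    exact hmin ht
  rw [hleast.csInf_eq]
  refine IsGLB.csInf_eq ⟨?_, ?_⟩ ⟨_, a, b, le_rfl, hab, le_rfl, rfl⟩
  · rintro _ ⟨u, v, hu, huv, hv, rfl⟩
    have hsub := Set.Icc_subset_Icc hu hv
    rw [hψ_eq u v hu huv hv, le_div_iff₀ (hint_pos u v hu huv hv),
      ← intervalIntegral.integral_const_mul]
    refine intervalIntegral.integral_mono_on huv.le
      ((continuousOn_const.mul (hG.mono hsub)).intervalIntegrable_of_Icc huv.le)
      ((hF.mono hsub).intervalIntegrable_of_Icc huv.le) fun t ht => ?_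
    exact (le_div_iff₀ (hGpos t (hsub ht))).1 (hmin (hsub ht))
  · refine fun c hc => le_of_forall_gt_imp_ge_of_dense fun d hd => ?_
    obtain ⟨u, v, hu, huv, hv, hlt⟩ := exists_Icc_subset_of_mem_nhdsWithin_Icc hab hm
      ((hquot m hm).eventually_lt_const hd)
    have hsub := Set.Icc_subset_Icc hu hv
    refine (hc ⟨u, v, hu, huv, hv, rfl⟩).trans ?_
    rw [hψ_eq u v hu huv hv, div_le_iff₀ (hint_pos u v hu huv hv),
      ← intervalIntegral.integral_const_mul]
    refine intervalIntegral.integral_mono_on huv.le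
      ((hF.mono hsub).intervalIntegrable_of_Icc huv.le)
      ((continuousOn_const.mul (hG.mono hsub)).intervalIntegrable_of_Icc huv.le) fun t ht => ?_
    exact (div_le_iff₀ (hGpos t (hsub ht))).1 (le_of_lt (hlt ht))
end

section
/- Let N ≥ 1 be a natural number, let p : ℕ → ℝ and q : ℕ → ℝ with q(t) > 0 for all t < N, let r₀ ∈ ℝ and s₀ ≥ 0, and for natural numbers t₀ < t₁ ≤ N define ψ(t₀,t₁) = ((∑_{t = t₀}^{t₁−1} p(t)) + r₀·(t₁ − t₀)) / ((∑_{t = t₀}^{t₁−1} q(t)) + s₀·(t₁ − t₀)). Then the supremum of ψ(t₀,t₁) over all pairs (t₀,t₁) with t₀ < t₁ ≤ N equals the supremum over t < N of (p(t) + r₀)/(q(t) + s₀). -/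
theorem sum_div_sum_le_of_forall_div_le {ι : Type*} {s : Finset ι} (hs : s.Nonempty)
    {f g : ι → ℝ} {C : ℝ} (hg : ∀ i ∈ s, 0 < g i) (h : ∀ i ∈ s, f i / g i ≤ C) :
    (∑ i ∈ s, f i) / ∑ i ∈ s, g i ≤ C := by
  rw [div_le_iff₀ (Finset.sum_pos hg hs), Finset.mul_sum]
  exact Finset.sum_le_sum fun i hi => (div_le_iff₀ (hg i hi)).1 (h i hi)

theorem sum_Ico_add_const (f : ℕ → ℝ) (c : ℝ) {a b : ℕ} (hab : a ≤ b) :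
    ∑ t ∈ Finset.Ico a b, (f t + c) =
      (∑ t ∈ Finset.Ico a b, f t) + c * ((b : ℝ) - (a : ℝ)) := by
  rw [Finset.sum_add_distrib, Finset.sum_const, Nat.card_Ico, nsmul_eq_mul, Nat.cast_sub hab,
    mul_comm]

theorem discreteFractionalFunction_sSup_eq (N : ℕ) (hN : 1 ≤ N)
    (p q : ℕ → ℝ) (hq : ∀ t < N, 0 < q t)
    (r₀ s₀ : ℝ) (hs₀ : 0 ≤ s₀)
    (ψ : ℕ → ℕ → ℝ)
    (hψ : ∀ t₀ t₁, t₀ < t₁ → t₁ ≤ N → ψ t₀ t₁ =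
      ((∑ t ∈ Finset.Ico t₀ t₁, p t) + r₀ * ((t₁ : ℝ) - (t₀ : ℝ))) /
      ((∑ t ∈ Finset.Ico t₀ t₁, q t) + s₀ * ((t₁ : ℝ) - (t₀ : ℝ)))) :
    sSup {x : ℝ | ∃ t₀ t₁, t₀ < t₁ ∧ t₁ ≤ N ∧ x = ψ t₀ t₁} =
    sSup {x : ℝ | ∃ t < N, x = (p t + r₀) / (q t + s₀)} := by
  have hbdd : BddAbove {x : ℝ | ∃ t < N, x = (p t + r₀) / (q t + s₀)} := by
    refine (((Set.finite_lt_nat N).image fun t => (p t + r₀) / (q t + s₀)).subset ?_).bddAbove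
    rintro x ⟨t, ht, rfl⟩
    exact ⟨t, ht, rfl⟩
  have hle : ∀ x ∈ {x : ℝ | ∃ t₀ t₁, t₀ < t₁ ∧ t₁ ≤ N ∧ x = ψ t₀ t₁},
      x ≤ sSup {x : ℝ | ∃ t < N, x = (p t + r₀) / (q t + s₀)} := by
    rintro x ⟨a, b, hab, hb, rfl⟩
    rw [hψ a b hab hb, ← sum_Ico_add_const p r₀ hab.le, ← sum_Ico_add_const q s₀ hab.le]
    have hlt : ∀ t ∈ Finset.Ico a b, t < N := fun t ht => (Finset.mem_Ico.1 ht).2.trans_le hb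
    exact sum_div_sum_le_of_forall_div_le (Finset.nonempty_Ico.2 hab)
      (fun t ht => add_pos_of_pos_of_nonneg (hq t (hlt t ht)) hs₀)
      (fun t ht => le_csSup hbdd ⟨t, hlt t ht, rfl⟩)
  refine le_antisymm (csSup_le ⟨_, 0, 1, one_pos, hN, rfl⟩ hle)
    (csSup_le_csSup ⟨_, hle⟩ ⟨_, 0, hN, rfl⟩ ?_)
  rintro x ⟨t, ht, rfl⟩
  refine ⟨t, t + 1, t.lt_succ_self, ht, ?_⟩
  simp [hψ t (t + 1) t.lt_succ_self ht]
end

section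
/- Let N ≥ 1 be a natural number, let p : ℕ → ℝ and q : ℕ → ℝ with q(t) > 0 for all t < N, let r₀ ∈ ℝ and s₀ ≥ 0, and for natural numbers t₀ < t₁ ≤ N define ψ(t₀,t₁) = ((∑_{t = t₀}^{t₁−1} p(t)) + r₀·(t₁ − t₀)) / ((∑_{t = t₀}^{t₁−1} q(t)) + s₀·(t₁ − t₀)). Then the infimum of ψ(t₀,t₁) over all pairs (t₀,t₁) with t₀ < t₁ ≤ N equals the infimum over t < N of (p(t) + r₀)/(q(t) + s₀). -/
/-- A lower bound for the pointwise quotients `f i / g i` with positive denominators is a lower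
bound for the quotient of the sums. -/
theorem le_sum_div_sum_of_forall_le_div {ι : Type*} {s : Finset ι} (hs : s.Nonempty)
    {f g : ι → ℝ} {m : ℝ} (hg : ∀ i ∈ s, 0 < g i) (hm : ∀ i ∈ s, m ≤ f i / g i) :
    m ≤ (∑ i ∈ s, f i) / ∑ i ∈ s, g i := by
  rw [le_div_iff₀ (Finset.sum_pos hg hs), Finset.mul_sum]
  exact Finset.sum_le_sum fun i hi => (le_div_iff₀ (hg i hi)).1 (hm i hi)

theorem sum_Ico_add_const_eq {a b : ℕ} (hab : a ≤ b) (f : ℕ → ℝ) (c : ℝ) :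
    ∑ t ∈ Finset.Ico a b, (f t + c) = (∑ t ∈ Finset.Ico a b, f t) + c * ((b : ℝ) - (a : ℝ)) := by
  rw [Finset.sum_add_distrib, Finset.sum_const, Nat.card_Ico, nsmul_eq_mul, Nat.cast_sub hab,
    mul_comm]

theorem discreteFractionalFunction_sInf_eq (N : ℕ) (hN : 1 ≤ N)
    (p q : ℕ → ℝ) (hq : ∀ t < N, 0 < q t)
    (r₀ s₀ : ℝ) (hs₀ : 0 ≤ s₀)
    (ψ : ℕ → ℕ → ℝ)
    (hψ : ∀ t₀ t₁, t₀ < t₁ → t₁ ≤ N → ψ t₀ t₁ =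
      ((∑ t ∈ Finset.Ico t₀ t₁, p t) + r₀ * ((t₁ : ℝ) - (t₀ : ℝ))) /
      ((∑ t ∈ Finset.Ico t₀ t₁, q t) + s₀ * ((t₁ : ℝ) - (t₀ : ℝ)))) :
    sInf {x : ℝ | ∃ t₀ t₁, t₀ < t₁ ∧ t₁ ≤ N ∧ x = ψ t₀ t₁} =
    sInf {x : ℝ | ∃ t < N, x = (p t + r₀) / (q t + s₀)} := by
  set A := {x : ℝ | ∃ t₀ t₁, t₀ < t₁ ∧ t₁ ≤ N ∧ x = ψ t₀ t₁}
  set B := {x : ℝ | ∃ t < N, x = (p t + r₀) / (q t + s₀)}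
  have hBA : B ⊆ A := by
    rintro x ⟨t, ht, rfl⟩
    refine ⟨t, t + 1, t.lt_succ_self, ht, ?_⟩
    rw [hψ t (t + 1) t.lt_succ_self ht]
    simp
  have hB : B.Nonempty := ⟨_, 0, hN, rfl⟩
  have hB_bdd : BddBelow B := by
    refine (((Set.finite_lt_nat N).image fun t => (p t + r₀) / (q t + s₀)).subset ?_).bddBelow
    rintro x ⟨t, ht, rfl⟩
    exact ⟨t, ht, rfl⟩
  have hA : ∀ x ∈ A, sInf B ≤ x := by
    rintro x ⟨a, b, hab, hb, rfl⟩
    rw [hψ a b hab hb, ← sum_Ico_add_const_eq hab.le, ← sum_Ico_add_const_eq hab.le]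
    have hlt : ∀ t ∈ Finset.Ico a b, t < N := fun t ht => (Finset.mem_Ico.1 ht).2.trans_le hb
    exact le_sum_div_sum_of_forall_le_div (Finset.nonempty_Ico.2 hab)
      (fun t ht => add_pos_of_pos_of_nonneg (hq t (hlt t ht)) hs₀)
      (fun t ht => csInf_le hB_bdd ⟨t, hlt t ht, rfl⟩)
  exact le_antisymm (csInf_le_csInf ⟨_, hA⟩ hB hBA) (le_csInf (hB.mono hBA) hA)
end

section
/- Let N ≥ 1 be a natural number, let p, q : ℕ → ℝ with q(t) ≥ 0 for all t < N and with p(t) = 0 whenever q(t) = 0 (for t < N), let r₀ ≤ 0, and assume there exists t < N with q(t) > 0. For natural numbers t₀ < t₁ ≤ N with ∑_{t = t₀}^{t₁−1} q(t) > 0 define ψ(t₀,t₁) = ((∑_{t = t₀}^{t₁−1} p(t)) + r₀·(t₁ − t₀)) / (∑_{t = t₀}^{t₁−1} q(t)). Then the supremum of ψ(t₀,t₁) over all such pairs (t₀,t₁) equals the supremum of (p(t) + r₀)/q(t) over all t < N with q(t) > 0. -/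
theorem discreteFractionalFunction_deadZone_sSup_eq (N : ℕ) (hN : 1 ≤ N)
    (p q : ℕ → ℝ) (hq : ∀ t < N, 0 ≤ q t)
    (hpq : ∀ t < N, q t = 0 → p t = 0)
    (r₀ : ℝ) (hr₀ : r₀ ≤ 0)
    (hex : ∃ t < N, 0 < q t)
    (ψ : ℕ → ℕ → ℝ)
    (hψ : ∀ t₀ t₁, t₀ < t₁ → t₁ ≤ N → 0 < ∑ t ∈ Finset.Ico t₀ t₁, q t → ψ t₀ t₁ =
      ((∑ t ∈ Finset.Ico t₀ t₁, p t) + r₀ * ((t₁ : ℝ) - (t₀ : ℝ))) /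
      (∑ t ∈ Finset.Ico t₀ t₁, q t)) :
    sSup {x : ℝ | ∃ t₀ t₁, t₀ < t₁ ∧ t₁ ≤ N ∧ 0 < ∑ t ∈ Finset.Ico t₀ t₁, q t ∧
        x = ψ t₀ t₁} =
    sSup {x : ℝ | ∃ t < N, 0 < q t ∧ x = (p t + r₀) / q t} := by
  set A := {x : ℝ | ∃ t₀ t₁, t₀ < t₁ ∧ t₁ ≤ N ∧ 0 < ∑ t ∈ Finset.Ico t₀ t₁, q t ∧
    x = ψ t₀ t₁}
  set B := {x : ℝ | ∃ t < N, 0 < q t ∧ x = (p t + r₀) / q t}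
  have hBbdd : BddAbove B := by
    refine (((Finset.range N).finite_toSet.image fun t => (p t + r₀) / q t).subset ?_).bddAbove
    rintro x ⟨t, ht, -, rfl⟩
    exact ⟨t, by simpa using ht, rfl⟩
  have hBne : B.Nonempty := by
    obtain ⟨t, ht, hqt⟩ := hex
    exact ⟨_, t, ht, hqt, rfl⟩
  have hBA : B ⊆ A := by
    rintro x ⟨t, ht, hqt, rfl⟩
    have hsum : 0 < ∑ s ∈ Finset.Ico t (t + 1), q s := by simpa using hqt
    refine ⟨t, t + 1, t.lt_succ_self, ht, hsum, ?_⟩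
    rw [hψ t (t + 1) t.lt_succ_self ht hsum]
    simp
  have hpoint : ∀ t < N, p t + r₀ ≤ sSup B * q t := by
    intro t ht
    rcases (hq t ht).eq_or_lt with h | h
    · rw [hpq t ht h.symm, ← h]
      linarith
    · exact (div_le_iff₀ h).1 (le_csSup hBbdd ⟨t, ht, h, rfl⟩)
  have hA : ∀ x ∈ A, x ≤ sSup B := by
    rintro x ⟨t₀, t₁, hlt, hle, hsum, rfl⟩
    rw [hψ t₀ t₁ hlt hle hsum, div_le_iff₀ hsum, Finset.mul_sum]
    have h := Finset.sum_le_sum fun t (ht : t ∈ Finset.Ico t₀ t₁) =>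
      hpoint t ((Finset.mem_Ico.1 ht).2.trans_le hle)
    rw [Finset.sum_add_distrib, Finset.sum_const, Nat.card_Ico, nsmul_eq_mul,
      Nat.cast_sub hlt.le] at h
    linarith
  exact le_antisymm (csSup_le (hBne.mono hBA) hA) (csSup_le_csSup ⟨_, hA⟩ hBne hBA)
end

section
/- Let N ≥ 1 be a natural number, let p, q : ℕ → ℝ with q(t) ≥ 0 for all t < N and with p(t) = 0 whenever q(t) = 0 (for t < N), let r₀ ≥ 0, and assume there exists t < N with q(t) > 0. For natural numbers t₀ < t₁ ≤ N with ∑_{t = t₀}^{t₁−1} q(t) > 0 define ψ(t₀,t₁) = ((∑_{t = t₀}^{t₁−1} p(t)) + r₀·(t₁ − t₀)) / (∑_{t = t₀}^{t₁−1} q(t)). Then the infimum of ψ(t₀,t₁) over all such pairs (t₀,t₁) equals the infimum of (p(t) + r₀)/q(t) over all t < N with q(t) > 0. -/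
/-- A mediant inequality: a lower bound for the ratios `(p t + r) / q t` with `0 < q t` is a lower
bound for the ratio of the sums, terms with `q t = 0` being harmless as `p t = 0` there. -/
theorem le_sum_add_card_mul_div_sum {ι : Type*} (s : Finset ι) (p q : ι → ℝ) {r c : ℝ}
    (hr : 0 ≤ r) (hq : ∀ t ∈ s, 0 ≤ q t) (hpq : ∀ t ∈ s, q t = 0 → p t = 0)
    (hc : ∀ t ∈ s, 0 < q t → c ≤ (p t + r) / q t) (hs : 0 < ∑ t ∈ s, q t) :
    c ≤ ((∑ t ∈ s, p t) + r * (s.card : ℝ)) / ∑ t ∈ s, q t := by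
  rw [le_div_iff₀ hs]
  have hterm : ∀ t ∈ s, c * q t ≤ p t + r := by
    intro t ht
    rcases (hq t ht).eq_or_lt with h0 | hpos
    · simpa [← h0, hpq t ht h0.symm] using hr
    · exact (le_div_iff₀ hpos).1 (hc t ht hpos)
  calc c * ∑ t ∈ s, q t = ∑ t ∈ s, c * q t := Finset.mul_sum _ _ _
    _ ≤ ∑ t ∈ s, (p t + r) := Finset.sum_le_sum hterm
    _ = (∑ t ∈ s, p t) + r * (s.card : ℝ) := by
      rw [Finset.sum_add_distrib, Finset.sum_const, nsmul_eq_mul, mul_comm r]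

theorem discreteFractionalFunction_deadZone_sInf_eq (N : ℕ) (hN : 1 ≤ N)
    (p q : ℕ → ℝ) (hq : ∀ t < N, 0 ≤ q t)
    (hpq : ∀ t < N, q t = 0 → p t = 0)
    (r₀ : ℝ) (hr₀ : 0 ≤ r₀)
    (hex : ∃ t < N, 0 < q t)
    (ψ : ℕ → ℕ → ℝ)
    (hψ : ∀ t₀ t₁, t₀ < t₁ → t₁ ≤ N → 0 < ∑ t ∈ Finset.Ico t₀ t₁, q t → ψ t₀ t₁ =
      ((∑ t ∈ Finset.Ico t₀ t₁, p t) + r₀ * ((t₁ : ℝ) - (t₀ : ℝ))) /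
      (∑ t ∈ Finset.Ico t₀ t₁, q t)) :
    sInf {x : ℝ | ∃ t₀ t₁, t₀ < t₁ ∧ t₁ ≤ N ∧ 0 < ∑ t ∈ Finset.Ico t₀ t₁, q t ∧
        x = ψ t₀ t₁} =
    sInf {x : ℝ | ∃ t < N, 0 < q t ∧ x = (p t + r₀) / q t} := by
  set A := {x : ℝ | ∃ t₀ t₁, t₀ < t₁ ∧ t₁ ≤ N ∧ 0 < ∑ t ∈ Finset.Ico t₀ t₁, q t ∧ x = ψ t₀ t₁}
  set B := {x : ℝ | ∃ t < N, 0 < q t ∧ x = (p t + r₀) / q t}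
  have hBA : B ⊆ A := by
    rintro x ⟨t, ht, hpos, rfl⟩
    have hsum : 0 < ∑ i ∈ Finset.Ico t (t + 1), q i := by simpa using hpos
    refine ⟨t, t + 1, t.lt_succ_self, ht, hsum, ?_⟩
    rw [hψ t (t + 1) t.lt_succ_self ht hsum]
    simp
  have hB : B.Nonempty := by
    obtain ⟨t, ht, hpos⟩ := hex
    exact ⟨_, t, ht, hpos, rfl⟩
  have hBbdd : BddBelow B := by
    refine (((Finset.range N).finite_toSet.image fun t => (p t + r₀) / q t).subset ?_).bddBelow
    rintro x ⟨t, ht, -, rfl⟩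
    exact ⟨t, by simpa using ht, rfl⟩
  have hlower : sInf B ∈ lowerBounds A := by
    rintro x ⟨t₀, t₁, hlt, hle, hsum, rfl⟩
    have hN' : ∀ t ∈ Finset.Ico t₀ t₁, t < N := fun t ht => (Finset.mem_Ico.1 ht).2.trans_le hle
    rw [hψ t₀ t₁ hlt hle hsum, ← Nat.cast_sub hlt.le, ← Nat.card_Ico]
    exact le_sum_add_card_mul_div_sum _ p q hr₀ (fun t ht => hq t (hN' t ht))
      (fun t ht => hpq t (hN' t ht))
      (fun t ht hpos => csInf_le hBbdd ⟨t, hN' t ht, hpos, rfl⟩) hsum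
  exact le_antisymm (csInf_le_csInf ⟨_, hlower⟩ hB hBA) (le_csInf (hB.mono hBA) hlower)
end

section
/- Let a < b be real numbers, let f, g : ℝ → ℝ be continuous on [a,b] with g(t) ≥ 0 for all t ∈ [a,b] and f(t) = 0 whenever g(t) = 0 (for t ∈ [a,b]), and let r₀ ≤ 0. Then for any a ≤ t₀ < t₁ ≤ b with ∫_{t₀}^{t₁} g(t) dt > 0, there exists t ∈ [t₀,t₁] with g(t) > 0 such that (∫_{t₀}^{t₁} f(t) dt + r₀·(t₁ − t₀)) / (∫_{t₀}^{t₁} g(t) dt) ≤ (f(t) + r₀)/g(t). -/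
theorem fractionalFunction_deadZone_le_pointwise (a b : ℝ) (hab : a < b) (f g : ℝ → ℝ)
    (hf : ContinuousOn f (Set.Icc a b)) (hg : ContinuousOn g (Set.Icc a b))
    (hgnonneg : ∀ t ∈ Set.Icc a b, 0 ≤ g t)
    (hfg : ∀ t ∈ Set.Icc a b, g t = 0 → f t = 0)
    (r₀ : ℝ) (hr₀ : r₀ ≤ 0)
    (t₀ t₁ : ℝ) (h0 : a ≤ t₀) (h01 : t₀ < t₁) (h1 : t₁ ≤ b)
    (hint : 0 < ∫ t in t₀..t₁, g t) :
    ∃ t ∈ Set.Icc t₀ t₁, 0 < g t ∧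
      ((∫ t in t₀..t₁, f t) + r₀ * (t₁ - t₀)) / (∫ t in t₀..t₁, g t) ≤
        (f t + r₀) / g t := by
  have hsub : Set.Icc t₀ t₁ ⊆ Set.Icc a b := Set.Icc_subset_Icc h0 h1
  have hf' := hf.mono hsub
  have hg' := hg.mono hsub
  have hfi := hf'.intervalIntegrable_of_Icc (μ := MeasureTheory.volume) h01.le
  have hgi := hg'.intervalIntegrable_of_Icc (μ := MeasureTheory.volume) h01.le
  by_contra! hcon
  set ψ := ((∫ t in t₀..t₁, f t) + r₀ * (t₁ - t₀)) / (∫ t in t₀..t₁, g t) with hψ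
  have hlt : ∀ t ∈ Set.Icc t₀ t₁, 0 < g t → f t + r₀ < ψ * g t := fun t ht hgt ↦
    (div_lt_iff₀ hgt).1 (hcon t ht hgt)
  have hle : ∀ t ∈ Set.Icc t₀ t₁, f t + r₀ ≤ ψ * g t := by
    intro t ht
    rcases (hgnonneg t (hsub ht)).eq_or_lt with h | h
    · simpa [← h, hfg t (hsub ht) h.symm] using hr₀
    · exact (hlt t ht h).le
  obtain ⟨c, hc, hgc⟩ : ∃ c ∈ Set.Icc t₀ t₁, 0 < g c := by
    by_contra! h
    refine hint.not_ge ?_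
    simpa using intervalIntegral.integral_mono_on h01.le hgi
      (intervalIntegrable_const (c := (0 : ℝ))) h
  have key := intervalIntegral.integral_lt_integral_of_continuousOn_of_le_of_exists_lt
    (f := fun t ↦ f t + r₀) h01
    (hf'.add continuousOn_const) (hg'.const_mul ψ)
    (fun t ht ↦ hle t (Set.Ioc_subset_Icc_self ht)) ⟨c, hc, hlt c hc hgc⟩
  rw [intervalIntegral.integral_add hfi intervalIntegrable_const,
    intervalIntegral.integral_const, intervalIntegral.integral_const_mul, hψ,
    div_mul_cancel₀ _ hint.ne', smul_eq_mul, mul_comm r₀] at key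
  exact lt_irrefl _ key
end

section
/- Let a < b be real numbers, let f, g : ℝ → ℝ be continuous on [a,b] with g(t) ≥ 0 for all t ∈ [a,b] and f(t) = 0 whenever g(t) = 0 (for t ∈ [a,b]), and let r₀ ≥ 0. Then for any a ≤ t₀ < t₁ ≤ b with ∫_{t₀}^{t₁} g(t) dt > 0, there exists t ∈ [t₀,t₁] with g(t) > 0 such that (f(t) + r₀)/g(t) ≤ (∫_{t₀}^{t₁} f(t) dt + r₀·(t₁ − t₀)) / (∫_{t₀}^{t₁} g(t) dt). -/
theorem fractionalFunction_deadZone_ge_pointwise (a b : ℝ) (hab : a < b) (f g : ℝ → ℝ)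
    (hf : ContinuousOn f (Set.Icc a b)) (hg : ContinuousOn g (Set.Icc a b))
    (hgnonneg : ∀ t ∈ Set.Icc a b, 0 ≤ g t)
    (hfg : ∀ t ∈ Set.Icc a b, g t = 0 → f t = 0)
    (r₀ : ℝ) (hr₀ : 0 ≤ r₀)
    (t₀ t₁ : ℝ) (h0 : a ≤ t₀) (h01 : t₀ < t₁) (h1 : t₁ ≤ b)
    (hint : 0 < ∫ t in t₀..t₁, g t) :
    ∃ t ∈ Set.Icc t₀ t₁, 0 < g t ∧
      (f t + r₀) / g t ≤
        ((∫ t in t₀..t₁, f t) + r₀ * (t₁ - t₀)) / (∫ t in t₀..t₁, g t) := by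
  have hsub : Set.Icc t₀ t₁ ⊆ Set.Icc a b := Set.Icc_subset_Icc h0 h1
  have hf' := hf.mono hsub
  have hg' := hg.mono hsub
  have hfi : IntervalIntegrable f MeasureTheory.volume t₀ t₁ :=
    hf'.intervalIntegrable_of_Icc h01.le
  set C := ((∫ t in t₀..t₁, f t) + r₀ * (t₁ - t₀)) / (∫ t in t₀..t₁, g t) with hC
  by_contra! hcon
  have hlt : ∀ t ∈ Set.Icc t₀ t₁, 0 < g t → C * g t < f t + r₀ := fun t ht hgt =>
    (lt_div_iff₀ hgt).1 (hcon t ht hgt)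
  have hle : ∀ t ∈ Set.Icc t₀ t₁, C * g t ≤ f t + r₀ := by
    intro t ht
    rcases (hgnonneg t (hsub ht)).eq_or_lt with h | h
    · simpa [← h, hfg t (hsub ht) h.symm] using hr₀
    · exact (hlt t ht h).le
  obtain ⟨c, hc, hgc⟩ : ∃ c ∈ Set.Icc t₀ t₁, 0 < g c := by
    by_contra! hg0
    have := intervalIntegral.integral_mono_on (μ := MeasureTheory.volume) h01.le
      (hg'.intervalIntegrable_of_Icc h01.le)
      (intervalIntegrable_const (c := (0 : ℝ))) hg0
    simp only [intervalIntegral.integral_zero] at this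
    exact this.not_gt hint
  have hI := intervalIntegral.integral_lt_integral_of_continuousOn_of_le_of_exists_lt
    (f := fun t => C * g t) (g := fun t => f t + r₀) h01
    (continuousOn_const.mul hg') (hf'.add continuousOn_const)
    (fun t ht => hle t (Set.Ioc_subset_Icc_self ht)) ⟨c, hc, hlt c hc hgc⟩
  rw [intervalIntegral.integral_const_mul,
    intervalIntegral.integral_add hfi intervalIntegrable_const,
    intervalIntegral.integral_const, smul_eq_mul, hC, div_mul_cancel₀ _ hint.ne',
    mul_comm r₀] at hI
  exact lt_irrefl _ hI
end

section
/- Let a < b be real numbers, m ≥ 1 a natural number, and let u, y : ℝ → ℝ^m be continuous on [a,b]. Let γ ∈ ℝ, K_s ≥ 0, and let S : ℝ → ℝ satisfy |S(t) − S(s)| ≤ K_s·|t − s| for all s, t ∈ [a,b], together with the dissipation inequality S(t₁) − S(t₀) ≤ ∫_{t₀}^{t₁} (γ²·‖u(t)‖² − ‖y(t)‖²) dt for all a ≤ t₀ ≤ t₁ ≤ b. Then for every t ∈ [a,b) with u(t) ≠ 0, (‖y(t)‖² − K_s)/‖u(t)‖² ≤ γ². -/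
/-- A continuous function whose integrals over subintervals `[t, r]` are all at least
`c * (r - t)` is itself at least `c` at `t`. -/
theorem le_of_forall_mul_sub_le_integral {a b c t : ℝ} {g : ℝ → ℝ}
    (hg : ContinuousOn g (Set.Icc a b)) (ht : t ∈ Set.Ico a b)
    (hint : ∀ r ∈ Set.Icc t b, c * (r - t) ≤ ∫ x in t..r, g x) : c ≤ g t := by
  by_contra! hlt
  obtain ⟨d, hgd, hdc⟩ := exists_between hlt
  have hcont : ContinuousWithinAt g (Set.Icc t b) t :=
    (hg t ⟨ht.1, ht.2.le⟩).mono (Set.Icc_subset_Icc_left ht.1)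
  have hev : ∀ᶠ x in nhdsWithin t (Set.Ici t), g x < d := by
    rw [← nhdsWithin_Icc_eq_nhdsGE ht.2]
    exact hcont.eventually_lt_const hgd
  obtain ⟨r, ⟨htr, hrb⟩, hr⟩ := (mem_nhdsGE_iff_exists_mem_Ioc_Ico_subset ht.2).1 hev
  obtain ⟨q, htq, hqr⟩ := exists_between htr
  have hqb : q ≤ b := hqr.le.trans hrb
  have hle : ∫ x in t..q, g x ≤ ∫ _ in t..q, d := by
    refine intervalIntegral.integral_mono_on htq.le ?_ intervalIntegrable_const
      fun x hx => (hr ⟨hx.1, hx.2.trans_lt hqr⟩).le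
    exact (hg.mono (Set.Icc_subset_Icc ht.1 hqb)).intervalIntegrable_of_Icc htq.le
  rw [intervalIntegral.integral_const, smul_eq_mul] at hle
  nlinarith [hint q ⟨htq.le, hqb⟩]

theorem l2gain_pointwise_lower_bound (a b : ℝ) (hab : a < b) (m : ℕ) (hm : 1 ≤ m)
    (u y : ℝ → EuclideanSpace ℝ (Fin m))
    (hu : ContinuousOn u (Set.Icc a b)) (hy : ContinuousOn y (Set.Icc a b))
    (γ Ks : ℝ) (hKs : 0 ≤ Ks) (S : ℝ → ℝ)
    (hS : ∀ s ∈ Set.Icc a b, ∀ t ∈ Set.Icc a b, |S t - S s| ≤ Ks * |t - s|)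
    (hdiss : ∀ t₀ t₁, a ≤ t₀ → t₀ ≤ t₁ → t₁ ≤ b →
      S t₁ - S t₀ ≤ ∫ t in t₀..t₁, (γ ^ 2 * ‖u t‖ ^ 2 - ‖y t‖ ^ 2)) :
    ∀ t ∈ Set.Ico a b, u t ≠ 0 → (‖y t‖ ^ 2 - Ks) / ‖u t‖ ^ 2 ≤ γ ^ 2 := by
  intro t ht hut
  have hg : ContinuousOn (fun x => γ ^ 2 * ‖u x‖ ^ 2 - ‖y x‖ ^ 2) (Set.Icc a b) := by
    fun_prop
  have hbound : -Ks ≤ γ ^ 2 * ‖u t‖ ^ 2 - ‖y t‖ ^ 2 := by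
    refine le_of_forall_mul_sub_le_integral
      (g := fun x => γ ^ 2 * ‖u x‖ ^ 2 - ‖y x‖ ^ 2) hg ht fun r hr => ?_
    have hlip := hS t ⟨ht.1, ht.2.le⟩ r ⟨ht.1.trans hr.1, hr.2⟩
    rw [abs_of_nonneg (sub_nonneg.2 hr.1)] at hlip
    linarith [hdiss t r ht.1 hr.1 hr.2, (abs_le.1 hlip).1]
  rw [div_le_iff₀ (by positivity)]
  linarith
end

section
/- Let a < b be real numbers, m ≥ 1 a natural number, and let u, y : ℝ → ℝ^m be continuous on [a,b]. Let ν ∈ ℝ, K_s ≥ 0, and let S : ℝ → ℝ satisfy |S(t) − S(s)| ≤ K_s·|t − s| for all s, t ∈ [a,b], together with the dissipation inequality S(t₁) − S(t₀) ≤ ∫_{t₀}^{t₁} (⟨u(t), y(t)⟩ − ν·‖u(t)‖²) dt for all a ≤ t₀ ≤ t₁ ≤ b, where ⟨·,·⟩ is the Euclidean inner product. Then for every t ∈ [a,b) with u(t) ≠ 0, ν ≤ (⟨u(t), y(t)⟩ + K_s)/‖u(t)‖². -/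
open scoped RealInnerProductSpace

/-- If the increments of a `K`-Lipschitz function over intervals starting at `t` are bounded by the
integrals of a continuous function `f`, then `f t` is at least `-K`. -/
theorem neg_le_of_sub_le_integral {a b K t : ℝ} {S f : ℝ → ℝ}
    (hf : ContinuousOn f (Set.Icc a b)) (ht : t ∈ Set.Ico a b)
    (hS : ∀ r ∈ Set.Icc t b, |S r - S t| ≤ K * |r - t|)
    (hdiss : ∀ r ∈ Set.Icc t b, S r - S t ≤ ∫ x in t..r, f x) :
    -K ≤ f t := by
  by_contra! hlt
  obtain ⟨c, hfc, hcK⟩ := exists_between hlt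
  have hcont : ContinuousWithinAt f (Set.Icc t b) t :=
    (hf.mono (Set.Icc_subset_Icc_left ht.1)) t (Set.left_mem_Icc.2 ht.2.le)
  have hev : ∀ᶠ x in nhdsWithin t (Set.Ici t), f x < c ∧ x ≤ b := by
    rw [← nhdsWithin_Icc_eq_nhdsGE ht.2]
    filter_upwards [hcont.eventually_lt_const hfc, self_mem_nhdsWithin] with x hx hxb
    exact ⟨hx, hxb.2⟩
  obtain ⟨r, htr, hr⟩ := mem_nhdsGE_iff_exists_Icc_subset.1 hev
  replace htr : t < r := htr
  have hrb : r ≤ b := (hr (Set.right_mem_Icc.2 htr.le)).2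
  have hmem : r ∈ Set.Icc t b := ⟨htr.le, hrb⟩
  have hint : IntervalIntegrable f MeasureTheory.volume t r :=
    (hf.mono (Set.Icc_subset_Icc ht.1 hrb)).intervalIntegrable_of_Icc htr.le
  have hle : ∫ x in t..r, f x ≤ ∫ _ in t..r, c :=
    intervalIntegral.integral_mono_on htr.le hint intervalIntegrable_const
      fun x hx => (hr hx).1.le
  rw [intervalIntegral.integral_const, smul_eq_mul] at hle
  have hlow := (abs_le.1 (hS r hmem)).1
  rw [abs_of_pos (sub_pos.2 htr)] at hlow
  nlinarith [hdiss r hmem, mul_lt_mul_of_pos_right hcK (sub_pos.2 htr)]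

theorem ifp_pointwise_upper_bound (a b : ℝ) (hab : a < b) (m : ℕ) (hm : 1 ≤ m)
    (u y : ℝ → EuclideanSpace ℝ (Fin m))
    (hu : ContinuousOn u (Set.Icc a b)) (hy : ContinuousOn y (Set.Icc a b))
    (ν Ks : ℝ) (hKs : 0 ≤ Ks) (S : ℝ → ℝ)
    (hS : ∀ s ∈ Set.Icc a b, ∀ t ∈ Set.Icc a b, |S t - S s| ≤ Ks * |t - s|)
    (hdiss : ∀ t₀ t₁, a ≤ t₀ → t₀ ≤ t₁ → t₁ ≤ b →
      S t₁ - S t₀ ≤ ∫ t in t₀..t₁, (⟪u t, y t⟫ - ν * ‖u t‖ ^ 2)) :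
    ∀ t ∈ Set.Ico a b, u t ≠ 0 → ν ≤ (⟪u t, y t⟫ + Ks) / ‖u t‖ ^ 2 := by
  intro t ht hut
  have hf : ContinuousOn (fun x => ⟪u x, y x⟫ - ν * ‖u x‖ ^ 2) (Set.Icc a b) :=
    (hu.inner hy).sub (continuousOn_const.mul (hu.norm.pow 2))
  have key := neg_le_of_sub_le_integral hf ht
    (fun r hr => hS t ⟨ht.1, ht.2.le⟩ r ⟨ht.1.trans hr.1, hr.2⟩)
    (fun r hr => hdiss t r ht.1 hr.1 hr.2)
  rw [le_div_iff₀ (pow_pos (norm_pos_iff.2 hut) 2)]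
  linarith
end

section
/- Let a < b be real numbers, m ≥ 1 a natural number, and let u, y : ℝ → ℝ^m be continuous on [a,b]. Let ρ ∈ ℝ, K_s ≥ 0, and let S : ℝ → ℝ satisfy |S(t) − S(s)| ≤ K_s·|t − s| for all s, t ∈ [a,b], together with the dissipation inequality S(t₁) − S(t₀) ≤ ∫_{t₀}^{t₁} (⟨u(t), y(t)⟩ − ρ·‖y(t)‖²) dt for all a ≤ t₀ ≤ t₁ ≤ b, where ⟨·,·⟩ is the Euclidean inner product. Then for every t ∈ [a,b) with y(t) ≠ 0, ρ ≤ (⟨u(t), y(t)⟩ + K_s)/‖y(t)‖². -/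
open scoped RealInnerProductSpace

/-- A lower bound on the integrals of a continuous function over the intervals `[t, x]`, linear in
their length, passes to the value of the function at `t`. -/
theorem le_of_mul_sub_le_intervalIntegral {g : ℝ → ℝ} {t b c : ℝ} (htb : t < b)
    (hg : ContinuousOn g (Set.Icc t b))
    (h : ∀ x ∈ Set.Icc t b, c * (x - t) ≤ ∫ s in t..x, g s) : c ≤ g t := by
  by_contra! hlt
  obtain ⟨d, hgd, hdc⟩ := exists_between hlt
  have hev : ∀ᶠ s in nhdsWithin t (Set.Ici t), g s < d := by
    rw [← nhdsWithin_Icc_eq_nhdsGE htb]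
    exact (hg t ⟨le_rfl, htb.le⟩).eventually_lt_const hgd
  obtain ⟨x, ⟨htx, hxb⟩, hx⟩ := (mem_nhdsGE_iff_exists_mem_Ioc_Ico_subset htb).1 hev
  have hint : IntervalIntegrable g MeasureTheory.volume t x :=
    (hg.mono (Set.Icc_subset_Icc_right hxb)).intervalIntegrable_of_Icc htx.le
  have hle : ∫ s in t..x, g s ≤ ∫ _ in t..x, d :=
    intervalIntegral.integral_mono_on_of_le_Ioo htx.le hint intervalIntegrable_const
      fun s hs => (hx (Set.Ioo_subset_Ico_self hs)).le
  rw [intervalIntegral.integral_const, smul_eq_mul] at hle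
  nlinarith [h x ⟨htx.le, hxb⟩, mul_pos (sub_pos.2 hdc) (sub_pos.2 htx)]

theorem ofp_pointwise_upper_bound (a b : ℝ) (hab : a < b) (m : ℕ) (hm : 1 ≤ m)
    (u y : ℝ → EuclideanSpace ℝ (Fin m))
    (hu : ContinuousOn u (Set.Icc a b)) (hy : ContinuousOn y (Set.Icc a b))
    (ρ Ks : ℝ) (hKs : 0 ≤ Ks) (S : ℝ → ℝ)
    (hS : ∀ s ∈ Set.Icc a b, ∀ t ∈ Set.Icc a b, |S t - S s| ≤ Ks * |t - s|)
    (hdiss : ∀ t₀ t₁, a ≤ t₀ → t₀ ≤ t₁ → t₁ ≤ b →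
      S t₁ - S t₀ ≤ ∫ t in t₀..t₁, (⟪u t, y t⟫ - ρ * ‖y t‖ ^ 2)) :
    ∀ t ∈ Set.Ico a b, y t ≠ 0 → ρ ≤ (⟪u t, y t⟫ + Ks) / ‖y t‖ ^ 2 := by
  intro t ht hyt
  have hsub : Set.Icc t b ⊆ Set.Icc a b := Set.Icc_subset_Icc_left ht.1
  have hg : ContinuousOn (fun s => ⟪u s, y s⟫ - ρ * ‖y s‖ ^ 2) (Set.Icc t b) :=
    ((hu.inner hy).sub (continuousOn_const.mul (hy.norm.pow 2))).mono hsub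
  have key : -Ks ≤ ⟪u t, y t⟫ - ρ * ‖y t‖ ^ 2 := by
    refine le_of_mul_sub_le_intervalIntegral
      (g := fun s => ⟪u s, y s⟫ - ρ * ‖y s‖ ^ 2) ht.2 hg fun x hx => ?_
    have hlip := hS t ⟨ht.1, ht.2.le⟩ x (hsub hx)
    rw [abs_of_nonneg (sub_nonneg.2 hx.1)] at hlip
    linarith [neg_le_of_abs_le hlip, hdiss t x ht.1 hx.1 hx.2]
  rw [le_div_iff₀ (by positivity)]
  linarith
end

section
/- Let a < b be real numbers, m ≥ 1 a natural number, and let u, y : ℝ → ℝ^m be continuous on [a,b] with u(t) ≠ 0 for all t ∈ [a,b]. Define γ̂² = (∫_{a}^{b} ‖y(t)‖² dt)/(∫_{a}^{b} ‖u(t)‖² dt), γ̃² = sup_{t ∈ [a,b]} ‖y(t)‖²/‖u(t)‖², γ̄² = (γ̂² + γ̃²)/2, K_s = sup_{t ∈ [a,b]} (‖y(t)‖² − γ̄²·‖u(t)‖²), and γ̂*² = sup_{t ∈ [a,b]} (‖y(t)‖² − K_s)/‖u(t)‖². Then γ̂² − 2·(γ̃² − γ̂*²) ≤ γ̂*². 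-/
theorem ffo_l2gain_estimate_within_bound (a b : ℝ) (hab : a < b) (m : ℕ) (hm : 1 ≤ m)
    (u y : ℝ → EuclideanSpace ℝ (Fin m))
    (hu : ContinuousOn u (Set.Icc a b)) (hy : ContinuousOn y (Set.Icc a b))
    (hu0 : ∀ t ∈ Set.Icc a b, u t ≠ 0)
    (γhatSq γtildeSq γbarSq Ks γstarSq : ℝ)
    (hγhatSq : γhatSq = (∫ t in a..b, ‖y t‖ ^ 2) / (∫ t in a..b, ‖u t‖ ^ 2))
    (hγtildeSq : γtildeSq = sSup {x : ℝ | ∃ t ∈ Set.Icc a b, x = ‖y t‖ ^ 2 / ‖u t‖ ^ 2})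
    (hγbarSq : γbarSq = (γhatSq + γtildeSq) / 2)
    (hKs : Ks = sSup {x : ℝ | ∃ t ∈ Set.Icc a b, x = ‖y t‖ ^ 2 - γbarSq * ‖u t‖ ^ 2})
    (hγstarSq : γstarSq = sSup {x : ℝ | ∃ t ∈ Set.Icc a b, x = (‖y t‖ ^ 2 - Ks) / ‖u t‖ ^ 2}) :
    γhatSq - 2 * (γtildeSq - γstarSq) ≤ γstarSq := by
  have hU0 : ∀ t ∈ Set.Icc a b, 0 < ‖u t‖ ^ 2 := fun t ht =>
    pow_pos (norm_pos_iff.mpr (hu0 t ht)) 2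
  have hU : ContinuousOn (fun t => ‖u t‖ ^ 2) (Set.Icc a b) := hu.norm.pow 2
  have hY : ContinuousOn (fun t => ‖y t‖ ^ 2) (Set.Icc a b) := hy.norm.pow 2
  obtain ⟨s, hs, hs_max⟩ := isCompact_Icc.exists_isMaxOn (Set.nonempty_Icc.mpr hab.le)
    (hY.div hU fun t ht => (hU0 t ht).ne')
  have hs_eq : γtildeSq = ‖y s‖ ^ 2 / ‖u s‖ ^ 2 := by
    rw [hγtildeSq]
    refine IsGreatest.csSup_eq ⟨⟨s, hs, rfl⟩, ?_⟩
    rintro _ ⟨t, ht, rfl⟩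
    exact hs_max ht
  have hle : ∀ t ∈ Set.Icc a b, ‖y t‖ ^ 2 ≤ γtildeSq * ‖u t‖ ^ 2 := fun t ht => by
    rw [← div_le_iff₀ (hU0 t ht), hs_eq]
    exact hs_max ht
  have hUint : IntervalIntegrable (fun t => ‖u t‖ ^ 2) MeasureTheory.volume a b :=
    hU.intervalIntegrable_of_Icc hab.le
  have hUpos : 0 < ∫ t in a..b, ‖u t‖ ^ 2 :=
    intervalIntegral.intervalIntegral_pos_of_pos_on hUint
      (fun t ht => hU0 t (Set.Ioo_subset_Icc_self ht)) hab
  have hhat_le : γhatSq ≤ γtildeSq := by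
    rw [hγhatSq, div_le_iff₀ hUpos, ← intervalIntegral.integral_const_mul]
    exact intervalIntegral.integral_mono_on hab.le (hY.intervalIntegrable_of_Icc hab.le)
      (hUint.const_mul _) hle
  have hKs_nonneg : 0 ≤ Ks := by
    obtain ⟨r, -, hr_max⟩ := isCompact_Icc.exists_isMaxOn (Set.nonempty_Icc.mpr hab.le)
      (hY.sub (hU.const_mul γbarSq))
    have hs_le : ‖y s‖ ^ 2 - γbarSq * ‖u s‖ ^ 2 ≤ Ks := by
      rw [hKs]
      refine le_csSup ⟨‖y r‖ ^ 2 - γbarSq * ‖u r‖ ^ 2, ?_⟩ ⟨s, hs, rfl⟩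
      rintro _ ⟨t, ht, rfl⟩
      exact hr_max ht
    have hys : ‖y s‖ ^ 2 = γtildeSq * ‖u s‖ ^ 2 := by
      rw [hs_eq, div_mul_cancel₀ _ (hU0 s hs).ne']
    have hgap : 0 ≤ (γtildeSq - γbarSq) * ‖u s‖ ^ 2 :=
      mul_nonneg (by linarith) (hU0 s hs).le
    linarith
  have hstar_le : γstarSq ≤ γtildeSq := by
    rw [hγstarSq]
    refine csSup_le ⟨_, s, hs, rfl⟩ ?_
    rintro _ ⟨t, ht, rfl⟩
    rw [div_le_iff₀ (hU0 t ht)]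
    linarith [hle t ht]
  linarith
end
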